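/- arXiv:2312.16082 — 5 statements merged into one kernel-verified Lean document; each statement's English description precedes it below -/
import Mathlib

section
/- The observability and controllability matrices of a quantum linear system satisfy: (i) ⋂_{k∈ℕ} Ker(x ↦ ℂ(J_nℍ)^k x) = ⋂_{k∈ℕ} Ker(x ↦ 𝔹ᵀ((J_nℍ)ᵀ)^k J_n x); (ii) ⋂_{k∈ℕ} Ker(x ↦ ℂ(J_nℍ)^k J_n x) = (⨆_{k∈ℕ} Range(x ↦ (J_nℍ)^k 𝔹 x))^⊥, the orthogonal complement taken in the Euclidean space ℝ^{2n}. -/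
open Matrix

noncomputable section

/-- The matrix `J_k = [[0, I],[-I, 0]]` of size `2k × 2k`. -/
def Jmat (k : ℕ) : Matrix (Fin k ⊕ Fin k) (Fin k ⊕ Fin k) ℝ :=
  Matrix.fromBlocks 0 1 (-1) 0

theorem Jmat_transpose (k : ℕ) : (Jmat k)ᵀ = -Jmat k := by
  simp [Jmat, fromBlocks_transpose, fromBlocks_neg]

theorem Jmat_mul_self (k : ℕ) : Jmat k * Jmat k = -1 := by
  simp [Jmat, fromBlocks_multiply, ← fromBlocks_one, fromBlocks_neg]

theorem ker_toEuclideanLin_smul_Jmat_mul {n m : ℕ} {c : ℝ} (hc : c ≠ 0)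
    (X : Matrix (Fin m ⊕ Fin m) (Fin n ⊕ Fin n) ℝ) :
    LinearMap.ker (toEuclideanLin (c • (Jmat m * X))) = LinearMap.ker (toEuclideanLin X) := by
  ext x
  simp only [LinearMap.mem_ker, toLpLin_apply, WithLp.toLp_eq_zero, smul_mulVec,
    smul_eq_zero, hc, false_or, ← mulVec_mulVec]
  refine ⟨fun h => ?_, fun h => by rw [h, mulVec_zero]⟩
  simpa [mulVec_mulVec, Jmat_mul_self, ← Matrix.mul_assoc, neg_mulVec] using
    congrArg (Jmat m *ᵥ ·) h

theorem Jmat_mul_transpose_pow {n : ℕ} {H : Matrix (Fin n ⊕ Fin n) (Fin n ⊕ Fin n) ℝ}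
    (hH : H.IsSymm) (k : ℕ) :
    Jmat n * ((Jmat n * H)ᵀ) ^ k = (-1 : ℝ) ^ k • ((Jmat n * H) ^ k * Jmat n) := by
  have h : SemiconjBy (Jmat n) ((Jmat n * H)ᵀ) (-(Jmat n * H)) := by
    simp [SemiconjBy, transpose_mul, hH.eq, Jmat_transpose, Matrix.mul_assoc]
  rw [(h.pow_right k).eq, ← neg_one_smul ℝ (Jmat n * H), smul_pow, Matrix.smul_mul]

theorem transpose_ctrb_block {n m : ℕ} {H : Matrix (Fin n ⊕ Fin n) (Fin n ⊕ Fin n) ℝ}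
    (hH : H.IsSymm) (C : Matrix (Fin m ⊕ Fin m) (Fin n ⊕ Fin n) ℝ) (k : ℕ) :
    (Jmat n * Cᵀ * Jmat m)ᵀ * ((Jmat n * H)ᵀ) ^ k =
      (-1 : ℝ) ^ k • (Jmat m * (C * (Jmat n * H) ^ k * Jmat n)) := by
  have hB : (Jmat n * Cᵀ * Jmat m)ᵀ = Jmat m * C * Jmat n := by
    simp [transpose_mul, Jmat_transpose, Matrix.mul_assoc]
  rw [hB, Matrix.mul_assoc, Jmat_mul_transpose_pow hH, Matrix.mul_smul]
  simp only [Matrix.mul_assoc]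

theorem orthogonal_range_toEuclideanLin {ι κ : Type*} [Fintype ι] [DecidableEq ι] [Fintype κ]
    [DecidableEq κ] (A : Matrix ι κ ℝ) :
    (LinearMap.range (toEuclideanLin A))ᗮ = LinearMap.ker (toEuclideanLin Aᵀ) := by
  rw [LinearMap.orthogonal_range, ← toEuclideanLin_conjTranspose_eq_adjoint,
    conjTranspose_eq_transpose_of_trivial]

theorem obs_ctrb_relations (n m : ℕ)
    (H : Matrix (Fin n ⊕ Fin n) (Fin n ⊕ Fin n) ℝ) (hH : H.IsSymm)
    (C : Matrix (Fin m ⊕ Fin m) (Fin n ⊕ Fin n) ℝ) :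
    (⨅ k : ℕ, LinearMap.ker (Matrix.toEuclideanLin (C * (Jmat n * H) ^ k))) =
      (⨅ k : ℕ, LinearMap.ker (Matrix.toEuclideanLin
        ((Jmat n * Cᵀ * Jmat m)ᵀ * ((Jmat n * H)ᵀ) ^ k * Jmat n))) ∧
    (⨅ k : ℕ, LinearMap.ker (Matrix.toEuclideanLin (C * (Jmat n * H) ^ k * Jmat n))) =
      (⨆ k : ℕ, LinearMap.range (Matrix.toEuclideanLin
        ((Jmat n * H) ^ k * (Jmat n * Cᵀ * Jmat m))))ᗮ := by
  constructor
  · refine iInf_congr fun k => ?_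
    rw [transpose_ctrb_block hH, Matrix.smul_mul, Matrix.mul_assoc (Jmat m),
      Matrix.mul_assoc _ (Jmat n) (Jmat n), Jmat_mul_self, Matrix.mul_neg, Matrix.mul_one,
      Matrix.mul_neg, smul_neg, ← neg_smul, ker_toEuclideanLin_smul_Jmat_mul (by simp)]
  · rw [← Submodule.iInf_orthogonal]
    refine iInf_congr fun k => ?_
    rw [orthogonal_range_toEuclideanLin, transpose_mul, transpose_pow, transpose_ctrb_block hH,
      ker_toEuclideanLin_smul_Jmat_mul (by simp)]
end
end

section
/- Let 𝔸 := J_nℍ + (1/2) 𝔹 ℂ (which equals J_nℍ − (1/2)ℂ^♯ℂ). Then the controllable and unobservable subspaces computed from 𝔸 coincide with those computed from J_nℍ: ⨆_{k∈ℕ} Range(x ↦ 𝔸^k 𝔹 x) = ⨆_{k∈ℕ} Range(x ↦ (J_nℍ)^k 𝔹 x) and ⋂_{k∈ℕ} Ker(x ↦ ℂ 𝔸^k x) = ⋂_{k∈ℕ} Ker(x ↦ ℂ (J_nℍ)^k x). -/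
open Matrix

noncomputable section

namespace LinearMap

variable {R E F : Type*} [CommRing R] [AddCommGroup E] [Module R E] [AddCommGroup F] [Module R F]

/-- State feedback does not enlarge the controllable subspace. -/
lemma iSup_range_pow_feedback_le (a : E →ₗ[R] E) (b : F →ₗ[R] E) (c : E →ₗ[R] F) :
    (⨆ k : ℕ, range (((a + b ∘ₗ c) ^ k) ∘ₗ b)) ≤ ⨆ k : ℕ, range ((a ^ k) ∘ₗ b) := by
  set S := ⨆ k : ℕ, range ((a ^ k) ∘ₗ b) with hS
  have hb (x : F) : b x ∈ S := le_iSup (fun k : ℕ => range ((a ^ k) ∘ₗ b)) 0 ⟨x, by simp⟩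
  have ha : S ≤ S.comap a := by
    refine iSup_le fun k => ?_
    rintro _ ⟨x, rfl⟩
    exact le_iSup (fun k : ℕ => range ((a ^ k) ∘ₗ b)) (k + 1) ⟨x, by simp [pow_succ']⟩
  refine iSup_le fun k => ?_
  rintro _ ⟨x, rfl⟩
  induction k with
  | zero => simpa using hb x
  | succ k ih =>
    rw [comp_apply] at ih
    rw [comp_apply, pow_succ', Module.End.mul_apply, add_apply, comp_apply]
    exact S.add_mem (ha ih) (hb _)

/-- State feedback does not change the controllable subspace. -/
lemma iSup_range_pow_feedback (a : E →ₗ[R] E) (b : F →ₗ[R] E) (c : E →ₗ[R] F) :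
    (⨆ k : ℕ, range (((a + b ∘ₗ c) ^ k) ∘ₗ b)) = ⨆ k : ℕ, range ((a ^ k) ∘ₗ b) := by
  refine le_antisymm (iSup_range_pow_feedback_le a b c) ?_
  simpa [comp_neg] using iSup_range_pow_feedback_le (a + b ∘ₗ c) b (-c)

/-- Output injection does not shrink the unobservable subspace. -/
lemma iInf_ker_pow_le_injection (a : E →ₗ[R] E) (b : F →ₗ[R] E) (c : E →ₗ[R] F) :
    (⨅ k : ℕ, ker (c ∘ₗ a ^ k)) ≤ ⨅ k : ℕ, ker (c ∘ₗ (a + b ∘ₗ c) ^ k) := by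
  intro x hx
  simp only [Submodule.mem_iInf, mem_ker, comp_apply] at hx ⊢
  have hpow (k : ℕ) : ((a + b ∘ₗ c) ^ k) x = (a ^ k) x := by
    induction k with
    | zero => simp
    | succ k ih => simp [pow_succ', ih, hx]
  intro k
  rw [hpow, hx]

/-- Output injection does not change the unobservable subspace. -/
lemma iInf_ker_pow_injection (a : E →ₗ[R] E) (b : F →ₗ[R] E) (c : E →ₗ[R] F) :
    (⨅ k : ℕ, ker (c ∘ₗ (a + b ∘ₗ c) ^ k)) = ⨅ k : ℕ, ker (c ∘ₗ a ^ k) := by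
  refine le_antisymm ?_ (iInf_ker_pow_le_injection a b c)
  simpa [neg_comp] using iInf_ker_pow_le_injection (a + b ∘ₗ c) (-b) c

end LinearMap

theorem subspaces_from_A_eq_subspaces_from_JH (n m : ℕ)
    (H : Matrix (Fin n ⊕ Fin n) (Fin n ⊕ Fin n) ℝ) (hH : H.IsSymm)
    (C : Matrix (Fin m ⊕ Fin m) (Fin n ⊕ Fin n) ℝ)
    (B : Matrix (Fin n ⊕ Fin n) (Fin m ⊕ Fin m) ℝ) (hB : B = Jmat n * Cᵀ * Jmat m)
    (A : Matrix (Fin n ⊕ Fin n) (Fin n ⊕ Fin n) ℝ)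
    (hA : A = Jmat n * H + (1 / 2 : ℝ) • (B * C)) :
    (⨆ k : ℕ, LinearMap.range (Matrix.toEuclideanLin (A ^ k * B))) =
      (⨆ k : ℕ, LinearMap.range (Matrix.toEuclideanLin ((Jmat n * H) ^ k * B))) ∧
    (⨅ k : ℕ, LinearMap.ker (Matrix.toEuclideanLin (C * A ^ k))) =
      (⨅ k : ℕ, LinearMap.ker (Matrix.toEuclideanLin (C * (Jmat n * H) ^ k))) := by
  have hA' : Matrix.toEuclideanLin A = Matrix.toEuclideanLin (Jmat n * H) +
      ((1 / 2 : ℝ) • Matrix.toEuclideanLin B) ∘ₗ Matrix.toEuclideanLin C := by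
    rw [hA, map_add, map_smul, Matrix.toLpLin_mul 2 2 2 B C, LinearMap.smul_comp]
  simp only [Matrix.toLpLin_mul 2 2 2 (_ ^ _) B, Matrix.toLpLin_mul 2 2 2 C (_ ^ _),
    Matrix.toLpLin_pow]
  refine ⟨?_, ?_⟩
  · rw [hA', LinearMap.smul_comp, ← LinearMap.comp_smul]
    exact LinearMap.iSup_range_pow_feedback _ _ _
  · rw [hA']
    exact LinearMap.iInf_ker_pow_injection _ _ _
end
end

section
/- For k, ℓ : ℕ and complex k×ℓ matrices M, N, the matrix V_k := (1/√2)·[[I_k, I_k],[−i I_k, i I_k]] is unitary, and V_k · Δ(M,N) · V_ℓ^† equals the complex 2k×2ℓ block matrix [[Re(M+N), −Im(M−N)],[Im(M+N), Re(M−N)]] (whose entries are the indicated real numbers regarded as complex numbers), where Δ(M,N) := [[M, N],[N^#, M^#]] and N^#, M^# denote entrywise complex conjugation. -/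
open Matrix

noncomputable section

/-- The doubled-up matrix `Δ(M,N) = [[M, N],[N^#, M^#]]`. -/
def doubledUp {k l : ℕ} (M N : Matrix (Fin k) (Fin l) ℂ) :
    Matrix (Fin k ⊕ Fin k) (Fin l ⊕ Fin l) ℂ :=
  Matrix.fromBlocks M N (N.map (starRingEnd ℂ)) (M.map (starRingEnd ℂ))

/-- The unitary matrix `V_k = (1/√2)·[[I, I],[-iI, iI]]`. -/
def Vmat (k : ℕ) : Matrix (Fin k ⊕ Fin k) (Fin k ⊕ Fin k) ℂ :=
  ((Real.sqrt 2 : ℂ))⁻¹ •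
    Matrix.fromBlocks 1 1 (-(Complex.I • (1 : Matrix (Fin k) (Fin k) ℂ)))
      (Complex.I • (1 : Matrix (Fin k) (Fin k) ℂ))

theorem inv_sqrt_two_mul_self : ((Real.sqrt 2 : ℂ))⁻¹ * ((Real.sqrt 2 : ℂ))⁻¹ = 1 / 2 := by
  rw [← mul_inv, ← Complex.ofReal_mul, Real.mul_self_sqrt (by norm_num)]
  norm_num

theorem conjTranspose_Vmat (k : ℕ) :
    (Vmat k)ᴴ = ((Real.sqrt 2 : ℂ))⁻¹ •
      Matrix.fromBlocks 1 (Complex.I • (1 : Matrix (Fin k) (Fin k) ℂ)) 1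
        (-(Complex.I • (1 : Matrix (Fin k) (Fin k) ℂ))) := by
  simp [Vmat, Matrix.conjTranspose_smul, Matrix.fromBlocks_conjTranspose]

theorem Vmat_unitary_and_conj_doubledUp (k l : ℕ)
    (M N : Matrix (Fin k) (Fin l) ℂ) :
    Vmat k ∈ Matrix.unitaryGroup (Fin k ⊕ Fin k) ℂ ∧
    Vmat k * doubledUp M N * (Vmat l)ᴴ =
      Matrix.fromBlocks
        ((M + N).map fun z => (z.re : ℂ))
        (-((M - N).map fun z => (z.im : ℂ)))
        ((M + N).map fun z => (z.im : ℂ))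
        ((M - N).map fun z => (z.re : ℂ)) := by
  constructor
  · rw [Matrix.mem_unitaryGroup_iff, Matrix.star_eq_conjTranspose, conjTranspose_Vmat, Vmat,
      Matrix.smul_mul, Matrix.mul_smul, smul_smul, inv_sqrt_two_mul_self,
      Matrix.fromBlocks_multiply, Matrix.fromBlocks_smul, ← Matrix.fromBlocks_one]
    congr 1 <;> ext i j <;> simp [smul_smul] <;> ring
  · rw [conjTranspose_Vmat, Vmat, doubledUp, Matrix.smul_mul, Matrix.smul_mul, Matrix.mul_smul,
      smul_smul, inv_sqrt_two_mul_self, Matrix.fromBlocks_multiply, Matrix.fromBlocks_multiply,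
      Matrix.fromBlocks_smul]
    congr 1 <;> ext i j <;> apply Complex.ext <;> simp <;> ring
end
end

section
/- Let W be a real n×p matrix and V a real n×q matrix, each of full column rank (rank W = p and rank V = q). Define M̂ := (WᵀW)⁻¹ Wᵀ V (VᵀV)⁻¹ Vᵀ W. Then the intersection of the column spaces of W and V equals {W x : x ∈ ℝ^p, M̂ x = x}; that is, Range(x ↦ W x) ⊓ Range(x ↦ V x) = {y : ∃ x, y = W x ∧ M̂ x = x}. -/
open Matrix

noncomputable section

theorem isUnit_det_transpose_mul_self {m k : ℕ} {A : Matrix (Fin m) (Fin k) ℝ}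
    (hA : A.rank = k) : IsUnit (Aᵀ * A).det := by
  rw [← isUnit_iff_isUnit_det, ← mulVec_injective_iff_isUnit, mulVec_injective_iff,
    linearIndependent_iff_card_eq_finrank_span, Set.finrank, ← rank_eq_finrank_span_cols,
    rank_transpose_mul_self, hA, Fintype.card_fin]

/-- A vector `A *ᵥ x - B *ᵥ z` orthogonal to the columns of `A` and of `B` vanishes. -/
theorem mulVec_eq_mulVec_of_transpose_mulVec_eq {m k l : Type*} [Fintype m] [Fintype k] [Fintype l]
    {A : Matrix m k ℝ} {B : Matrix m l ℝ} {x : k → ℝ} {z : l → ℝ}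
    (hA : Aᵀ *ᵥ (A *ᵥ x) = Aᵀ *ᵥ (B *ᵥ z)) (hB : Bᵀ *ᵥ (A *ᵥ x) = Bᵀ *ᵥ (B *ᵥ z)) :
    A *ᵥ x = B *ᵥ z := by
  rw [← sub_eq_zero, ← dotProduct_self_eq_zero, dotProduct_sub, dotProduct_mulVec,
    dotProduct_mulVec, ← mulVec_transpose, ← mulVec_transpose, mulVec_sub,
    mulVec_sub, hA, hB, sub_self, sub_self, zero_dotProduct, zero_dotProduct,
    sub_zero]

theorem inter_column_spaces_eq (n p q : ℕ)
    (W : Matrix (Fin n) (Fin p) ℝ) (V : Matrix (Fin n) (Fin q) ℝ)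
    (hW : W.rank = p) (hV : V.rank = q)
    (M : Matrix (Fin p) (Fin p) ℝ)
    (hM : M = (Wᵀ * W)⁻¹ * Wᵀ * V * (Vᵀ * V)⁻¹ * Vᵀ * W) :
    ((LinearMap.range W.mulVecLin ⊓ LinearMap.range V.mulVecLin :
        Submodule ℝ (Fin n → ℝ)) : Set (Fin n → ℝ)) =
      {y | ∃ x : Fin p → ℝ, y = W.mulVec x ∧ M.mulVec x = x} := by
  have hWu := isUnit_det_transpose_mul_self hW
  have hVu := isUnit_det_transpose_mul_self hV
  have hMx (x : Fin p → ℝ) :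
      M *ᵥ x = (Wᵀ * W)⁻¹ *ᵥ (Wᵀ *ᵥ (V *ᵥ ((Vᵀ * V)⁻¹ *ᵥ (Vᵀ *ᵥ (W *ᵥ x))))) := by
    simp only [hM, mulVec_mulVec, Matrix.mul_assoc]
  have inv_mulVec {k : ℕ} {A : Matrix (Fin n) (Fin k) ℝ} (hA : IsUnit (Aᵀ * A).det)
      (x : Fin k → ℝ) : (Aᵀ * A)⁻¹ *ᵥ (Aᵀ *ᵥ (A *ᵥ x)) = x := by
    rw [mulVec_mulVec, mulVec_mulVec, Matrix.mul_assoc, nonsing_inv_mul _ hA, one_mulVec]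
  have mulVec_inv {k : ℕ} {A : Matrix (Fin n) (Fin k) ℝ} (hA : IsUnit (Aᵀ * A).det)
      (x : Fin k → ℝ) : Aᵀ *ᵥ (A *ᵥ ((Aᵀ * A)⁻¹ *ᵥ x)) = x := by
    rw [mulVec_mulVec, mulVec_mulVec, mul_nonsing_inv _ hA, one_mulVec]
  ext y
  constructor
  · rintro ⟨⟨x, rfl⟩, z, hz⟩
    simp only [mulVecLin_apply] at hz
    refine ⟨x, rfl, ?_⟩
    rw [hMx, ← hz, inv_mulVec hVu, hz, inv_mulVec hWu]
  · rintro ⟨x, rfl, hx⟩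
    refine ⟨⟨x, rfl⟩, (Vᵀ * V)⁻¹ *ᵥ (Vᵀ *ᵥ (W *ᵥ x)), ?_⟩
    refine (mulVec_eq_mulVec_of_transpose_mulVec_eq ?_ (mulVec_inv hVu _).symm).symm
    conv_lhs => rw [← hx, hMx, mulVec_inv hWu]
end
end

section
/- Let W be a real symmetric positive semidefinite 2n×2n matrix, and let U₁ (2n×r real) and U₂ (2n×(2n−r) real) satisfy U₁ᵀU₁ = I_r, U₂ᵀU₂ = I_{2n−r}, U₁ᵀU₂ = 0, U₁U₁ᵀ + U₂U₂ᵀ = I_{2n}, Range(x ↦ W x) = Range(x ↦ U₁ x) and Ker(x ↦ W x) = Range(x ↦ U₂ x). Then, with the subspaces R_c\bar{o} := (J_n · Im W) ⊓ Ker W, R_co := (J_n · Im W) ⊓ Im W, R_\bar{c}\bar{o} := Ker(x ↦ W J_n x) ⊓ Ker W, R_\bar{c}o := Ker(x ↦ W J_n x) ⊓ Im W, one has: R_c\bar{o} = Ker(I + J_nU₁U₁ᵀJ_nU₂U₂ᵀ), R_co = Ker(I + (J_nU₁U₁ᵀ)²), R_\bar{c}\bar{o} = Ker(I + (J_nU₂U₂ᵀ)²),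 and R_\bar{c}o = Ker(I + J_nU₂U₂ᵀJ_nU₁U₁ᵀ). -/
open Matrix

noncomputable section

theorem Jmat_mulVec_Jmat_mulVec (k : ℕ) (v : Fin k ⊕ Fin k → ℝ) :
    Jmat k *ᵥ (Jmat k *ᵥ v) = -v := by
  rw [mulVec_mulVec, Jmat_mul_self, neg_mulVec, one_mulVec]

theorem Jmat_mulVec_dotProduct_self (k : ℕ) (v : Fin k ⊕ Fin k → ℝ) :
    (Jmat k *ᵥ v) ⬝ᵥ (Jmat k *ᵥ v) = v ⬝ᵥ v := by
  rw [dotProduct_mulVec, ← mulVec_transpose, Jmat_transpose, neg_mulVec,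
    Jmat_mulVec_Jmat_mulVec, neg_neg]

theorem dotProduct_self_eq_of_symm_idempotent {ι : Type*} [Fintype ι] {A : Matrix ι ι ℝ}
    (hs : Aᵀ = A) (hi : A * A = A) (v : ι → ℝ) :
    v ⬝ᵥ v = (A *ᵥ v) ⬝ᵥ (A *ᵥ v) + (v - A *ᵥ v) ⬝ᵥ (v - A *ᵥ v) := by
  have h : (A *ᵥ v) ⬝ᵥ (A *ᵥ v) = (A *ᵥ v) ⬝ᵥ v := by
    rw [dotProduct_mulVec, ← mulVec_transpose, hs, mulVec_mulVec, hi]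
  simp only [sub_dotProduct, dotProduct_sub, h, dotProduct_comm v (A *ᵥ v)]
  ring

/-- For orthogonal projections `A` and `B`, the kernel of `I + J A J B` consists of the vectors
`x` in the range of `B` such that `J x` lies in the range of `A`. -/
theorem one_add_Jmat_mul_mulVec_eq_zero_iff {k : ℕ}
    {A B : Matrix (Fin k ⊕ Fin k) (Fin k ⊕ Fin k) ℝ} (hAs : Aᵀ = A) (hAi : A * A = A)
    (hBs : Bᵀ = B) (hBi : B * B = B) (x : Fin k ⊕ Fin k → ℝ) :
    (1 + Jmat k * A * Jmat k * B) *ᵥ x = 0 ↔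
      A *ᵥ (Jmat k *ᵥ x) = Jmat k *ᵥ x ∧ B *ᵥ x = x := by
  simp only [add_mulVec, one_mulVec, ← mulVec_mulVec]
  constructor
  · intro h
    have hx : x ⬝ᵥ x =
        (A *ᵥ (Jmat k *ᵥ (B *ᵥ x))) ⬝ᵥ (A *ᵥ (Jmat k *ᵥ (B *ᵥ x))) := by
      conv_lhs => rw [eq_neg_of_add_eq_zero_left h]
      rw [neg_dotProduct_neg, Jmat_mulVec_dotProduct_self]
    have hB := dotProduct_self_eq_of_symm_idempotent hBs hBi x
    have hA := dotProduct_self_eq_of_symm_idempotent hAs hAi (Jmat k *ᵥ (B *ᵥ x))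
    rw [Jmat_mulVec_dotProduct_self] at hA
    have hBnonneg : 0 ≤ (x - B *ᵥ x) ⬝ᵥ (x - B *ᵥ x) :=
      Finset.sum_nonneg fun i _ => mul_self_nonneg _
    have hAnonneg : 0 ≤ (Jmat k *ᵥ (B *ᵥ x) - A *ᵥ (Jmat k *ᵥ (B *ᵥ x))) ⬝ᵥ
        (Jmat k *ᵥ (B *ᵥ x) - A *ᵥ (Jmat k *ᵥ (B *ᵥ x))) :=
      Finset.sum_nonneg fun i _ => mul_self_nonneg _
    have hBx : B *ᵥ x = x :=
      (sub_eq_zero.mp (dotProduct_self_eq_zero.mp (by linarith))).symm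
    have hAx : A *ᵥ (Jmat k *ᵥ (B *ᵥ x)) = Jmat k *ᵥ (B *ᵥ x) :=
      (sub_eq_zero.mp (dotProduct_self_eq_zero.mp (by linarith))).symm
    exact ⟨by rwa [hBx] at hAx, hBx⟩
  · rintro ⟨hA, hB⟩
    rw [hB, hA, Jmat_mulVec_Jmat_mulVec, add_neg_cancel]

theorem mem_range_toEuclideanLin_iff_of_transpose_mul_self {ι κ : Type*} [Fintype ι]
    [Fintype κ] [DecidableEq κ] {U : Matrix ι κ ℝ} (hU : Uᵀ * U = 1)
    (x : EuclideanSpace ℝ ι) :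
    x ∈ LinearMap.range (Matrix.toEuclideanLin U) ↔ (U * Uᵀ) *ᵥ x.ofLp = x.ofLp := by
  constructor
  · rintro ⟨y, rfl⟩
    simp [mulVec_mulVec, Matrix.mul_assoc, hU]
  · intro h
    refine ⟨WithLp.toLp 2 (Uᵀ *ᵥ x.ofLp), ?_⟩
    rw [toLpLin_toLp, toLin'_apply, mulVec_mulVec, h]

theorem mem_ker_toEuclideanLin_iff {ι κ : Type*} [Fintype κ] [DecidableEq κ]
    (A : Matrix ι κ ℝ) (x : EuclideanSpace ℝ κ) :
    x ∈ LinearMap.ker (Matrix.toEuclideanLin A) ↔ A *ᵥ x.ofLp = 0 := by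
  rw [LinearMap.mem_ker, toLpLin_apply, WithLp.toLp_eq_zero]

theorem mem_map_Jmat_iff {k : ℕ} (S : Submodule ℝ (EuclideanSpace ℝ (Fin k ⊕ Fin k)))
    (x : EuclideanSpace ℝ (Fin k ⊕ Fin k)) :
    x ∈ S.map (Matrix.toEuclideanLin (Jmat k)) ↔ WithLp.toLp 2 (Jmat k *ᵥ x.ofLp) ∈ S := by
  constructor
  · rintro ⟨y, hy, rfl⟩
    simpa [Jmat_mul_self, neg_mulVec] using hy
  · intro h
    refine ⟨_, S.neg_mem h, ?_⟩
    rw [map_neg, toLpLin_toLp, toLin'_apply, Jmat_mulVec_Jmat_mulVec, WithLp.toLp_neg, neg_neg]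

theorem kalman_subspaces_as_kernels (n r : ℕ) (hr : r ≤ 2 * n)
    (W : Matrix (Fin n ⊕ Fin n) (Fin n ⊕ Fin n) ℝ) (hW : W.PosSemidef)
    (U₁ : Matrix (Fin n ⊕ Fin n) (Fin r) ℝ)
    (U₂ : Matrix (Fin n ⊕ Fin n) (Fin (2 * n - r)) ℝ)
    (hU₁ : U₁ᵀ * U₁ = 1) (hU₂ : U₂ᵀ * U₂ = 1) (hU₁₂ : U₁ᵀ * U₂ = 0)
    (hsum : U₁ * U₁ᵀ + U₂ * U₂ᵀ = 1)
    (hIm : LinearMap.range (Matrix.toEuclideanLin W) =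
      LinearMap.range (Matrix.toEuclideanLin U₁))
    (hKer : LinearMap.ker (Matrix.toEuclideanLin W) =
      LinearMap.range (Matrix.toEuclideanLin U₂)) :
    ((LinearMap.range (Matrix.toEuclideanLin W)).map
        (Matrix.toEuclideanLin (Jmat n)) ⊓
      LinearMap.ker (Matrix.toEuclideanLin W) =
        LinearMap.ker (Matrix.toEuclideanLin
          (1 + Jmat n * U₁ * U₁ᵀ * Jmat n * U₂ * U₂ᵀ))) ∧
    ((LinearMap.range (Matrix.toEuclideanLin W)).map
        (Matrix.toEuclideanLin (Jmat n)) ⊓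
      LinearMap.range (Matrix.toEuclideanLin W) =
        LinearMap.ker (Matrix.toEuclideanLin
          (1 + (Jmat n * U₁ * U₁ᵀ) ^ 2))) ∧
    (LinearMap.ker (Matrix.toEuclideanLin (W * Jmat n)) ⊓
      LinearMap.ker (Matrix.toEuclideanLin W) =
        LinearMap.ker (Matrix.toEuclideanLin
          (1 + (Jmat n * U₂ * U₂ᵀ) ^ 2))) ∧
    (LinearMap.ker (Matrix.toEuclideanLin (W * Jmat n)) ⊓
      LinearMap.range (Matrix.toEuclideanLin W) =
        LinearMap.ker (Matrix.toEuclideanLin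
          (1 + Jmat n * U₂ * U₂ᵀ * Jmat n * U₁ * U₁ᵀ))) := by
  have mem_im := fun x => mem_range_toEuclideanLin_iff_of_transpose_mul_self hU₁ x
  have mem_ker := fun x => mem_range_toEuclideanLin_iff_of_transpose_mul_self hU₂ x
  have mem_ker_J (x : EuclideanSpace ℝ (Fin n ⊕ Fin n)) :
      x ∈ LinearMap.ker (Matrix.toEuclideanLin (W * Jmat n)) ↔
        (U₂ * U₂ᵀ) *ᵥ (Jmat n *ᵥ x.ofLp) = Jmat n *ᵥ x.ofLp := by
    rw [mem_ker_toEuclideanLin_iff, ← mulVec_mulVec,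
      ← mem_ker (WithLp.toLp 2 (Jmat n *ᵥ x.ofLp)), ← hKer, mem_ker_toEuclideanLin_iff]
  have symm₁ : (U₁ * U₁ᵀ)ᵀ = U₁ * U₁ᵀ := by simp
  have symm₂ : (U₂ * U₂ᵀ)ᵀ = U₂ * U₂ᵀ := by simp
  have idem₁ : U₁ * U₁ᵀ * (U₁ * U₁ᵀ) = U₁ * U₁ᵀ := by
    rw [Matrix.mul_assoc, ← Matrix.mul_assoc U₁ᵀ, hU₁, Matrix.one_mul]
  have idem₂ : U₂ * U₂ᵀ * (U₂ * U₂ᵀ) = U₂ * U₂ᵀ := by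
    rw [Matrix.mul_assoc, ← Matrix.mul_assoc U₂ᵀ, hU₂, Matrix.one_mul]
  refine ⟨?_, ?_, ?_, ?_⟩ <;> ext x <;> rw [Submodule.mem_inf]
  · rw [mem_map_Jmat_iff, hIm, hKer, mem_im, mem_ker, mem_ker_toEuclideanLin_iff,
      ← one_add_Jmat_mul_mulVec_eq_zero_iff symm₁ idem₁ symm₂ idem₂]
    simp only [Matrix.mul_assoc]
  · rw [mem_map_Jmat_iff, hIm, mem_im, mem_im, mem_ker_toEuclideanLin_iff,
      ← one_add_Jmat_mul_mulVec_eq_zero_iff symm₁ idem₁ symm₁ idem₁]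
    simp only [Matrix.mul_assoc, pow_two]
  · rw [mem_ker_J, hKer, mem_ker, mem_ker_toEuclideanLin_iff,
      ← one_add_Jmat_mul_mulVec_eq_zero_iff symm₂ idem₂ symm₂ idem₂]
    simp only [Matrix.mul_assoc, pow_two]
  · rw [mem_ker_J, hIm, mem_im, mem_ker_toEuclideanLin_iff,
      ← one_add_Jmat_mul_mulVec_eq_zero_iff symm₂ idem₂ symm₁ idem₁]
    simp only [Matrix.mul_assoc]
end
end
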